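/- For a prime power q and prime ℓ with ℓ ∤ 2q, if the number of tuples t with |t| ≤ 2√q such that t² - 4q is a quadratic residue mod ℓ is denoted R, then |R - 2√q| ≪ √ℓ log ℓ + √q/ℓ; equivalently, among integers t in the Hasse interval, asymptotically half yield t² - 4q a square modulo ℓ. -/

import Mathlib

open scoped Classical

/-- A family of vectors with pairwise distinct nonzero valuations is linearly independent over a
field of scalars on which the valuation is trivial. -/
lemma Valuation.linearIndependent_of_injective {K L Γ ι : Type*} [Field K] [Field L] [Algebra K L]
    [LinearOrderedCommGroupWithZero Γ] (v : Valuation L Γ)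
    (hv : ∀ c : K, c ≠ 0 → v (algebraMap K L c) = 1) (m : ι → L) (hm : ∀ i, m i ≠ 0)
    (hinj : Function.Injective fun i => v (m i)) : LinearIndependent K m := by
  rw [linearIndependent_iff']
  intro s g hg
  by_contra! hne
  obtain ⟨i, his, hi⟩ := hne
  let t := s.filter fun i => g i ≠ 0
  have htne : t.Nonempty := ⟨i, by simp [t, his, hi]⟩
  obtain ⟨j, hj, hmax⟩ := t.exists_max_image (fun i => v (m i)) htne
  have hval : ∀ k ∈ t, v (g k • m k) = v (m k) := by
    intro k hk
    rw [Algebra.smul_def, map_mul, hv _ (Finset.mem_filter.1 hk).2, one_mul]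
  have hsum : ∑ k ∈ t, g k • m k = 0 := by
    rw [← hg]
    refine Finset.sum_subset (Finset.filter_subset _ _) fun k hk hkt => ?_
    have : g k = 0 := by
      by_contra h
      exact hkt (Finset.mem_filter.2 ⟨hk, h⟩)
    simp [this]
  have := v.map_sum_eq_of_lt hj (f := fun k => g k • m k)
    (by
      intro k hk
      have hkt := (Finset.mem_sdiff.1 hk).1
      have hkj : k ≠ j := by simpa using (Finset.mem_sdiff.1 hk).2
      rw [hval k hkt, hval j hj]
      exact lt_of_le_of_ne (hmax k hkt) fun h => hkj (hinj h))
  rw [hsum, map_zero, hval j hj] at this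
  exact hm j (v.zero_iff.1 this.symm)

/-- The Artin–Schreier curve `y ^ p - y = a x + b / x - d` has a place, trivial on the constants,
at which `x` has a pole of order `p` and `y` a pole of order `1`. -/
lemma exists_valuation_artinSchreier (K : Type) [Field K] [IsAlgClosed K] (p : ℕ) (hp : 2 ≤ p)
    (a b d : K) (ha : a ≠ 0) :
    ∃ (L : Type) (_ : Field L) (_ : Algebra K L) (Γ : Type)
      (_ : LinearOrderedCommGroupWithZero Γ) (v : Valuation L Γ) (x y : L),
      (∀ c : K, c ≠ 0 → v (algebraMap K L c) = 1) ∧ x ≠ 0 ∧ 1 < v y ∧ v x = v y ^ p ∧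
      y ^ p = y + (algebraMap K L a * x + algebraMap K L b * x⁻¹ - algebraMap K L d) := by
  let L := AlgebraicClosure (RatFunc K)
  let x : L := algebraMap (RatFunc K) L RatFunc.X
  let R : Subring L := (algebraMap K L).range
  have hxR : x ∉ R := by
    rintro ⟨c, hc⟩
    rw [IsScalarTower.algebraMap_apply K (RatFunc K) L] at hc
    have h2 := (algebraMap (RatFunc K) L).injective hc
    rw [RatFunc.algebraMap_eq_C, ← RatFunc.algebraMap_C, ← RatFunc.algebraMap_X] at h2
    exact Polynomial.X_ne_C c (RatFunc.algebraMap_injective K h2).symm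
  have hclosed : IsIntegrallyClosedIn R L := by
    rw [Subring.isIntegrallyClosedIn_iff]
    intro z hz
    have hz' : IsIntegral K z := by
      obtain ⟨P, hP, hP0⟩ := hz
      let e : K ≃+* R := RingEquiv.ofBijective (algebraMap K L).rangeRestrict
        ⟨fun u v h => (algebraMap K L).injective (congrArg Subtype.val h),
          (algebraMap K L).rangeRestrict_surjective⟩
      refine ⟨P.map (e.symm : R →+* K), hP.map _, ?_⟩
      rw [Polynomial.eval₂_map]
      convert hP0 using 2
      ext u
      obtain ⟨k, rfl⟩ := e.surjective u
      simp
      rfl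
    exact minpoly.mem_range_of_degree_eq_one K z
      (IsAlgClosed.degree_eq_one_of_irreducible K (minpoly.irreducible hz'))
  obtain ⟨V, hRV, hxV⟩ := Subring.exists_le_valuationSubring_of_isIntegrallyClosedIn hxR
  let v := V.valuation
  have hv : ∀ c : K, c ≠ 0 → v (algebraMap K L c) = 1 := by
    intro c hc
    have h1 : v (algebraMap K L c) ≤ 1 := (V.valuation_le_one_iff _).2 (hRV ⟨c, rfl⟩)
    have h2 : v (algebraMap K L c⁻¹) ≤ 1 := (V.valuation_le_one_iff _).2 (hRV ⟨c⁻¹, rfl⟩)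
    rw [map_inv₀, map_inv₀] at h2
    refine le_antisymm h1 ?_
    have h0 : 0 < v (algebraMap K L c) := by
      rw [zero_lt_iff]; simpa using hc
    exact (inv_le_one₀ h0).1 h2
  have hvle : ∀ c : K, v (algebraMap K L c) ≤ 1 := fun c =>
    (V.valuation_le_one_iff _).2 (hRV ⟨c, rfl⟩)
  have hx1 : 1 < v x := by
    rw [← not_le, V.valuation_le_one_iff]; exact hxV
  have hx0 : x ≠ 0 := by
    intro h; rw [h, map_zero] at hx1; exact absurd hx1 (not_lt.2 zero_le)
  obtain ⟨y, hy⟩ : ∃ y : L, y ^ p = y +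
      (algebraMap K L a * x + algebraMap K L b * x⁻¹ - algebraMap K L d) := by
    set w := algebraMap K L a * x + algebraMap K L b * x⁻¹ - algebraMap K L d
    let P : Polynomial L := Polynomial.X ^ p - (Polynomial.X + Polynomial.C w)
    have hdeg : (Polynomial.X + Polynomial.C w).degree < (p : WithBot ℕ) := by
      rw [Polynomial.degree_X_add_C]; exact_mod_cast hp
    have hPd : P.degree = p := by
      rw [Polynomial.degree_sub_eq_left_of_degree_lt] <;> rw [Polynomial.degree_X_pow]
      exact hdeg
    obtain ⟨y, hy⟩ := IsAlgClosed.exists_root P (by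
      rw [hPd]; exact_mod_cast (by omega : p ≠ 0))
    refine ⟨y, ?_⟩
    simpa [P, sub_eq_zero] using hy
  have hw : v (algebraMap K L a * x + algebraMap K L b * x⁻¹ - algebraMap K L d) = v x := by
    have hax : v (algebraMap K L a * x) = v x := by rw [map_mul, hv a ha, one_mul]
    rw [add_sub_assoc, v.map_add_eq_of_lt_left, hax]
    rw [hax]
    refine lt_of_le_of_lt (v.map_sub _ _) (max_lt ?_ ((hvle d).trans_lt hx1))
    rw [map_mul, map_inv₀]
    refine lt_of_le_of_lt (mul_le_one' (hvle b) ?_) hx1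
    exact inv_le_one_of_one_le₀ hx1.le
  have hy1 : 1 < v y := by
    by_contra! h
    have h1 : v (y ^ p - y) ≤ 1 := by
      refine (v.map_sub _ _).trans (max_le ?_ h)
      rw [map_pow]; exact pow_le_one₀ zero_le h
    rw [hy, add_sub_cancel_left, hw] at h1
    exact absurd hx1 (not_lt.2 h1)
  refine ⟨L, inferInstance, inferInstance, _, inferInstance, v, x, y, hv, hx0, hy1, ?_, hy⟩
  rw [← hw, ← map_pow, ← sub_eq_of_eq_add' hy, v.map_sub_eq_of_lt_left, map_pow]
  rw [map_pow]
  exact lt_self_pow₀ hy1 hp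

/-- The span of the monomials `x ^ k * y ^ e` with `lo ≤ k ≤ hi` and `e < d`. -/
def monomialSpan (K : Type*) {A : Type*} [Field K] [CommRing A] [Algebra K A] (x : Aˣ) (y : A)
    (lo hi : ℤ) (d : ℕ) : Submodule K A :=
  Submodule.span K (Set.range fun i : Finset.Icc lo hi × Fin d =>
    ((x ^ (i.1 : ℤ) : Aˣ) : A) * y ^ (i.2 : ℕ))

section monomialSpan

variable {K A : Type*} [Field K] [CommRing A] [Algebra K A] (x : Aˣ) (y : A)

lemma zpow_mul_pow_mem_monomialSpan {lo hi k : ℤ} {d e : ℕ} (h1 : lo ≤ k) (h2 : k ≤ hi)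
    (h3 : e < d) : ((x ^ k : Aˣ) : A) * y ^ e ∈ monomialSpan K x y lo hi d :=
  Submodule.subset_span ⟨(⟨k, Finset.mem_Icc.2 ⟨h1, h2⟩⟩, ⟨e, h3⟩), rfl⟩

lemma zpow_mem_monomialSpan {lo hi k : ℤ} {d : ℕ} (h1 : lo ≤ k) (h2 : k ≤ hi) (h3 : 0 < d) :
    ((x ^ k : Aˣ) : A) ∈ monomialSpan K x y lo hi d := by
  simpa using zpow_mul_pow_mem_monomialSpan (K := K) x y h1 h2 h3

lemma monomialSpan_mono {lo hi lo' hi' : ℤ} {d d' : ℕ} (h1 : lo' ≤ lo) (h2 : hi ≤ hi')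
    (h3 : d ≤ d') : monomialSpan K x y lo hi d ≤ monomialSpan K x y lo' hi' d' := by
  refine Submodule.span_le.2 ?_
  rintro _ ⟨⟨⟨k, hk⟩, ⟨e, he⟩⟩, rfl⟩
  rw [Finset.mem_Icc] at hk
  exact zpow_mul_pow_mem_monomialSpan x y (h1.trans hk.1) (hk.2.trans h2) (he.trans_le h3)

lemma mul_mem_monomialSpan {lo hi lo' hi' : ℤ} {d d' : ℕ} {u v : A}
    (hu : u ∈ monomialSpan K x y lo hi (d + 1)) (hv : v ∈ monomialSpan K x y lo' hi' (d' + 1)) :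
    u * v ∈ monomialSpan K x y (lo + lo') (hi + hi') (d + d' + 1) := by
  have := Submodule.mul_mem_mul hu hv
  rw [monomialSpan, monomialSpan, Submodule.span_mul_span] at this
  refine Submodule.span_le.2 ?_ this
  rintro _ ⟨_, ⟨⟨⟨k, hk⟩, ⟨e, he⟩⟩, rfl⟩, _, ⟨⟨⟨k', hk'⟩, ⟨e', he'⟩⟩, rfl⟩, rfl⟩
  rw [Finset.mem_Icc] at hk hk'
  have := zpow_mul_pow_mem_monomialSpan (K := K) x y (lo := lo + lo') (hi := hi + hi')
    (k := k + k') (d := d + d' + 1) (e := e + e') (by omega) (by omega) (by omega)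
  have heq : ((x ^ k : Aˣ) : A) * y ^ e * (((x ^ k' : Aˣ) : A) * y ^ e') =
      ((x ^ (k + k') : Aˣ) : A) * y ^ (e + e') := by
    rw [zpow_add, Units.val_mul, pow_add]
    ring
  simpa only [SetLike.mem_coe, heq] using this

lemma pow_mem_monomialSpan {N : ℤ} {d : ℕ} {u : A}
    (hu : u ∈ monomialSpan K x y (-N) N (d + 1)) (n : ℕ) :
    u ^ n ∈ monomialSpan K x y (-(n * N)) (n * N) (n * d + 1) := by
  induction n with
  | zero => simpa using zpow_mem_monomialSpan (K := K) x y (lo := 0) (hi := 0) (k := 0) (d := 1)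
  | succ n ih =>
    rw [pow_succ]
    have h := mul_mem_monomialSpan x y ih hu
    have e1 : -((n : ℤ) * N) + -N = -((n + 1 : ℕ) * N) := by push_cast; ring
    have e2 : (n : ℤ) * N + N = (n + 1 : ℕ) * N := by push_cast; ring
    rwa [e1, e2, ← Nat.succ_mul] at h

lemma smul_mul_zpow_pow_mem {lo hi : ℤ} {d : ℕ} (c : K) {k : ℤ} {e : ℕ} (h1 : lo ≤ k)
    (h2 : k ≤ hi) (h3 : e < d) :
    algebraMap K A c * (((x ^ k : Aˣ) : A) * y ^ e) ∈ monomialSpan K x y lo hi d := by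
  rw [← Algebra.smul_def]
  exact Submodule.smul_mem _ _ (zpow_mul_pow_mem_monomialSpan x y h1 h2 h3)

/-- Reduction of `y`-exponents below `p` by means of the Artin–Schreier relation. -/
lemma monomialSpan_reduce {p : ℕ} (hp : 2 ≤ p) (a b d : K)
    (hrel : y ^ p = y + (algebraMap K A a * x + algebraMap K A b * ((x⁻¹ : Aˣ) : A)
      - algebraMap K A d)) (lo hi : ℤ) :
    monomialSpan K x y lo hi (2 * p - 1) ≤ monomialSpan K x y (lo - 1) (hi + 1) p := by
  refine Submodule.span_le.2 ?_
  rintro _ ⟨⟨⟨k, hk⟩, ⟨e, he⟩⟩, rfl⟩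
  rw [Finset.mem_Icc] at hk
  rcases lt_or_ge e p with h | h
  · exact zpow_mul_pow_mem_monomialSpan x y ((sub_one_lt lo).le.trans hk.1)
      (hk.2.trans (lt_add_one hi).le) h
  obtain ⟨f, rfl⟩ := Nat.exists_eq_add_of_le h
  have key : ((x ^ k : Aˣ) : A) * y ^ (p + f) = ((x ^ k : Aˣ) : A) * y ^ (f + 1) +
      algebraMap K A a * (((x ^ (k + 1) : Aˣ) : A) * y ^ f) +
      algebraMap K A b * (((x ^ (k - 1) : Aˣ) : A) * y ^ f) -
      algebraMap K A d * (((x ^ k : Aˣ) : A) * y ^ f) := by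
    rw [pow_add, hrel, zpow_add_one, zpow_sub_one, Units.val_mul, Units.val_mul]
    ring
  simp only [SetLike.mem_coe]
  rw [key]
  refine sub_mem (add_mem (add_mem ?_ ?_) ?_) ?_
  · exact zpow_mul_pow_mem_monomialSpan x y (by omega) (by omega) (by omega)
  all_goals exact smul_mul_zpow_pow_mem x y _ (by omega) (by omega) (by omega)

/-- Iterating the Artin–Schreier relation. -/
lemma pow_prime_pow_eq {p : ℕ} [Fact p.Prime] [CharP A p] {u w : A} (h : u ^ p = u + w) (r : ℕ) :
    u ^ p ^ r = u + ∑ k ∈ Finset.range r, w ^ p ^ k := by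
  induction r with
  | zero => simp
  | succ r ih =>
    rw [pow_succ, pow_mul, ih, add_pow_char, sum_pow_char, h, Finset.sum_range_succ']
    simp only [pow_zero, pow_one, ← pow_mul, ← pow_succ]
    ring

lemma pow_prime_pow_mem_monomialSpan {p : ℕ} [Fact p.Prime] [CharP A p] (a b d : K)
    (hrel : y ^ p = y + (algebraMap K A a * x + algebraMap K A b * ((x⁻¹ : Aˣ) : A)
      - algebraMap K A d)) (r : ℕ) :
    y ^ p ^ (r + 1) ∈ monomialSpan K x y (-(p ^ r : ℕ)) (p ^ r : ℕ) 2 := by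
  rw [pow_prime_pow_eq hrel]
  have hp : 0 < p := (Fact.out : p.Prime).pos
  refine add_mem ?_ (sum_mem fun k hk => ?_)
  · simpa using zpow_mul_pow_mem_monomialSpan (K := K) x y (lo := -(p ^ r : ℕ))
      (hi := (p ^ r : ℕ)) (k := 0) (d := 2) (e := 1) (by omega) (by omega) (by omega)
  have hk' : p ^ k ≤ p ^ r := Nat.pow_le_pow_right hp (by simpa using Nat.lt_succ_iff.1 (Finset.mem_range.1 hk))
  rw [sub_pow_char_pow, add_pow_char_pow, mul_pow, mul_pow, ← map_pow, ← map_pow, ← map_pow,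
    ← Units.val_pow_eq_pow_val, ← Units.val_pow_eq_pow_val]
  have h1 := smul_mul_zpow_pow_mem (K := K) x y (lo := -(p ^ r : ℕ)) (hi := (p ^ r : ℕ)) (d := 2)
    (a ^ p ^ k) (k := (p ^ k : ℕ)) (e := 0) (by omega) (by omega) (by omega)
  have h2 := smul_mul_zpow_pow_mem (K := K) x y (lo := -(p ^ r : ℕ)) (hi := (p ^ r : ℕ)) (d := 2)
    (b ^ p ^ k) (k := -(p ^ k : ℕ)) (e := 0) (by omega) (by omega) (by omega)
  have h3 := smul_mul_zpow_pow_mem (K := K) x y (lo := -(p ^ r : ℕ)) (hi := (p ^ r : ℕ)) (d := 2)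
    (d ^ p ^ k) (k := 0) (e := 0) (by omega) (by omega) (by omega)
  rw [zpow_natCast, pow_zero, mul_one] at h1
  rw [zpow_neg, zpow_natCast, ← inv_pow, pow_zero, mul_one] at h2
  rw [zpow_zero, pow_zero, mul_one, Units.val_one, mul_one] at h3
  exact sub_mem (add_mem h1 h2) h3

/-- The exponents `j * p ^ (r + 1) + t` of `y`, with `j, t < p`, can be reduced below `p`. -/
lemma zpow_mul_pow_mul_pow_mem {p : ℕ} [Fact p.Prime] [CharP A p] (a b d : K)
    (hrel : y ^ p = y + (algebraMap K A a * x + algebraMap K A b * ((x⁻¹ : Aˣ) : A)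
      - algebraMap K A d)) (r : ℕ) {k lo hi : ℤ} {j t : ℕ} (hj : j < p) (ht : t < p)
    (h1 : lo ≤ k - ((p - 1) * p ^ r + 1)) (h2 : k + ((p - 1) * p ^ r + 1) ≤ hi) :
    ((x ^ k : Aˣ) : A) * y ^ (j * p ^ (r + 1) + t) ∈ monomialSpan K x y lo hi p := by
  have hp : 2 ≤ p := (Fact.out : p.Prime).two_le
  have hA := pow_mem_monomialSpan x y
    (pow_prime_pow_mem_monomialSpan x y a b d hrel r) j
  have hB := zpow_mul_pow_mem_monomialSpan (K := K) x y (k := k) le_rfl le_rfl (Nat.lt_succ_self t)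
  have hC := mul_mem_monomialSpan x y hB hA
  have hjr : (j : ℤ) * (p ^ r : ℕ) ≤ (p - 1) * p ^ r := by
    push_cast
    exact mul_le_mul_of_nonneg_right (by omega) (by positivity)
  have hD := monomialSpan_reduce x y hp a b d hrel (k - (p - 1) * p ^ r) (k + (p - 1) * p ^ r)
    (monomialSpan_mono x y (by omega) (by omega) (by omega) hC)
  rw [add_comm (j * _), pow_add, mul_comm j, pow_mul, ← mul_assoc]
  exact monomialSpan_mono x y (by omega) (by omega) le_rfl hD

end monomialSpan

lemma finrank_monomialSpan_le (K : Type*) {A : Type*} [Field K] [CommRing A] [Algebra K A]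
    (x : Aˣ) (y : A) (lo hi : ℤ) (d : ℕ) :
    Module.finrank K (monomialSpan K x y lo hi d) ≤ (hi + 1 - lo).toNat * d := by
  refine (finrank_range_le_card _).trans ?_
  simp

/-- The number of `x`-coordinates of points at which a nonzero combination of monomials vanishes,
when at each of those `x`-coordinates the whole fibre is in its zero set. -/
lemma card_le_of_forall_algHom_eq_zero {K A : Type*} [Field K] [CommRing A] [Algebra K A]
    (x : Aˣ) (y : A) (lo hi : ℤ) (p : ℕ) (G : A)
    (hG : G ∈ monomialSpan K x y lo hi p) (hG0 : G ≠ 0) (Z : Finset K)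
    (hZ : ∀ x₀ ∈ Z, ∃ ys : Finset K, p ≤ ys.card ∧ ∀ y₀ ∈ ys, ∃ ε : A →ₐ[K] K,
      ε x = x₀ ∧ ε y = y₀ ∧ ε G = 0) (hlohi : lo ≤ hi) : (Z.card : ℤ) ≤ hi - lo := by
  obtain ⟨g, hg⟩ := (Submodule.mem_span_range_iff_exists_fun K).1 hG
  obtain ⟨⟨k₁, e₁⟩, hke⟩ : ∃ i, g i ≠ 0 := by
    by_contra! h
    exact hG0 (by rw [← hg]; simp [h])
  let P : Polynomial K := ∑ k : Finset.Icc lo hi,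
    Polynomial.C (g (k, e₁)) * Polynomial.X ^ ((k : ℤ) - lo).toNat
  have hinj : ∀ k k' : Finset.Icc lo hi,
      ((k : ℤ) - lo).toNat = ((k' : ℤ) - lo).toNat → k = k' := by
    rintro ⟨k, hk⟩ ⟨k', hk'⟩ h
    rw [Finset.mem_Icc] at hk hk'
    simp only [Subtype.mk.injEq] at h ⊢
    omega
  have hP0 : P ≠ 0 := by
    intro h
    apply hke
    have hc := congrArg (fun q => q.coeff ((k₁ : ℤ) - lo).toNat) h
    simp only [P, Polynomial.finsetSum_coeff, Polynomial.coeff_C_mul, Polynomial.coeff_X_pow,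
      Polynomial.coeff_zero] at hc
    rw [Finset.sum_eq_single k₁] at hc
    · simpa using hc
    · intro k _ hk
      rw [if_neg fun h => hk (hinj _ _ h).symm, mul_zero]
    · simp
  have hPdeg : P.natDegree ≤ (hi - lo).toNat := by
    refine Polynomial.natDegree_sum_le_of_forall_le _ _ fun k _ => ?_
    refine (Polynomial.natDegree_C_mul_X_pow_le _ _).trans ?_
    have := Finset.mem_Icc.1 k.2
    omega
  have hroot : ∀ x₀ ∈ Z, P.eval x₀ = 0 := by
    intro x₀ hx₀
    obtain ⟨ys, hcard, hys⟩ := hZ x₀ hx₀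
    have hp : 0 < p := e₁.pos
    have hx₀0 : x₀ ≠ 0 := by
      obtain ⟨y₀, hy₀⟩ := Finset.card_pos.1 (hp.trans_le hcard)
      obtain ⟨ε, hx, -⟩ := hys y₀ hy₀
      rw [← hx]
      exact (x.isUnit.map ε).ne_zero
    let q : Polynomial K := ∑ e : Fin p,
      Polynomial.C (∑ k : Finset.Icc lo hi, g (k, e) * x₀ ^ (k : ℤ)) * Polynomial.X ^ (e : ℕ)
    have hqdeg : q.natDegree < ys.card := by
      refine lt_of_le_of_lt (b := p - 1) ?_ (by omega)
      refine Polynomial.natDegree_sum_le_of_forall_le _ _ fun e _ => ?_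
      exact (Polynomial.natDegree_C_mul_X_pow_le _ _).trans (by omega)
    have hq : q = 0 := by
      refine Polynomial.eq_zero_of_natDegree_lt_card_of_eval_eq_zero' q ys (fun y₀ hy₀ => ?_) hqdeg
      obtain ⟨ε, hx, hy, h0⟩ := hys y₀ hy₀
      rw [← hg, map_sum, Fintype.sum_prod_type, Finset.sum_comm] at h0
      rw [← h0]
      simp only [q, Polynomial.eval_finsetSum, Polynomial.eval_mul, Polynomial.eval_C,
        Polynomial.eval_pow, Polynomial.eval_X]
      refine Finset.sum_congr rfl fun e _ => ?_
      rw [Finset.sum_mul]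
      refine Finset.sum_congr rfl fun k _ => ?_
      have hxz : ε ((x ^ (k : ℤ) : Aˣ) : A) = x₀ ^ (k : ℤ) := by
        have := congrArg Units.val (map_zpow (Units.map (ε : A →* K)) x (k : ℤ))
        rw [Units.val_zpow_eq_zpow_val] at this
        rw [← hx]
        exact this
      rw [map_smul, map_mul, hxz, map_pow, hy, smul_eq_mul, mul_assoc]
    have hc := congrArg (fun q => q.coeff (e₁ : ℕ)) hq
    simp only [q, Polynomial.finsetSum_coeff, Polynomial.coeff_C_mul, Polynomial.coeff_X_pow,
      Polynomial.coeff_zero] at hc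
    rw [Finset.sum_eq_single e₁ (fun e _ he => by
      rw [if_neg fun h => he (Fin.ext h.symm), mul_zero]) (by simp), if_pos rfl, mul_one] at hc
    have : P.eval x₀ = x₀ ^ (-lo) * ∑ k : Finset.Icc lo hi, g (k, e₁) * x₀ ^ (k : ℤ) := by
      simp only [P, Polynomial.eval_finsetSum, Polynomial.eval_mul, Polynomial.eval_C,
        Polynomial.eval_pow, Polynomial.eval_X, Finset.mul_sum]
      refine Finset.sum_congr rfl fun k _ => ?_
      have hk := Finset.mem_Icc.1 k.2
      rw [← zpow_natCast, Int.toNat_of_nonneg (by omega), sub_eq_neg_add, zpow_add₀ hx₀0]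
      ring
    rw [this, hc, mul_zero]
  have hle := Polynomial.card_le_degree_of_subset_roots (p := P) (Z := Z) (by
    intro x₀ hx₀
    rw [Polynomial.mem_roots hP0]
    exact hroot x₀ (by simpa using hx₀))
  omega

lemma card_artinSchreier_fibre {K : Type*} [Field K] [IsAlgClosed K] (p : ℕ) [Fact p.Prime]
    [CharP K p] (w : K) : ∃ ys : Finset K, ys.card = p ∧ ∀ y ∈ ys, y ^ p = y + w := by
  have hp : 2 ≤ p := (Fact.out : p.Prime).two_le
  let P : Polynomial K := Polynomial.X ^ p - (Polynomial.X + Polynomial.C w)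
  have hPd : P.degree = p := by
    rw [Polynomial.degree_sub_eq_left_of_degree_lt] <;> rw [Polynomial.degree_X_pow]
    rw [Polynomial.degree_X_add_C]; exact_mod_cast hp
  obtain ⟨y, hy⟩ := IsAlgClosed.exists_root P (by rw [hPd]; exact_mod_cast (by omega : p ≠ 0))
  have hy' : y ^ p = y + w := by simpa [P, sub_eq_zero] using hy
  refine ⟨Finset.univ.image fun c : ZMod p => y + ZMod.castHom (dvd_refl p) K c, ?_, ?_⟩
  · rw [Finset.card_image_of_injective, Finset.card_univ, ZMod.card]
    exact fun c c' h => (ZMod.castHom (dvd_refl p) K).injective (add_left_cancel h)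
  · intro z hz
    obtain ⟨c, -, rfl⟩ := Finset.mem_image.1 hz
    rw [add_pow_char, hy', ← map_pow, ZMod.pow_card]
    ring

lemma exists_relation_of_lt {K A ι : Type*} [Field K] [CommRing A] [Algebra K A] [Fintype ι]
    (x : Aˣ) (y : A) (lo hi : ℤ) (d : ℕ) (m : ι → A) (hm : ∀ i, m i ∈ monomialSpan K x y lo hi d)
    (hlt : (hi + 1 - lo).toNat * d < Fintype.card ι) :
    ∃ g : ι → K, ∑ i, g i • m i = 0 ∧ ∃ i, g i ≠ 0 := by
  let W := monomialSpan K x y lo hi d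
  have hfin : Module.Finite K W := Module.Finite.span_of_finite K (Set.finite_range _)
  have hnot : ¬ LinearIndependent K (fun i => (⟨m i, hm i⟩ : W)) := fun h =>
    absurd (h.fintype_card_le_finrank.trans (finrank_monomialSpan_le K x y lo hi d)) (by omega)
  obtain ⟨g, hg, hne⟩ := Fintype.not_linearIndependent_iff.1 hnot
  refine ⟨g, ?_, hne⟩
  simpa using congrArg Subtype.val hg

lemma Nat.mul_add_inj_of_lt {d u u' w w' : ℕ} (hu : u < d) (hu' : u' < d)
    (h : d * w + u = d * w' + u') : w = w' ∧ u = u' := by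
  have hd : 0 < d := by omega
  have h1 := congrArg (· / d) h
  simp only [Nat.mul_add_div hd, Nat.div_eq_of_lt hu, Nat.div_eq_of_lt hu', add_zero] at h1
  subst h1
  exact ⟨rfl, by omega⟩

/-- Stepanov's bound in Bombieri's form: the Artin–Schreier curve `y ^ p - y = a x + b / x - d`
has at most `p * (Q / p + O(√Q))` points rational over the field with `Q = p ^ (2 r + 2)` elements
outside its poles. -/
lemma card_le_of_sum_pow_eq {K : Type} [Field K] [IsAlgClosed K] (p : ℕ) [Fact p.Prime]
    [CharP K p] (hp3 : 3 ≤ p) (a b c : K) (ha : a ≠ 0) (r : ℕ) (Z : Finset K)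
    (hZ : ∀ x ∈ Z, x ≠ 0 ∧ x ^ p ^ (2 * (r + 1)) = x ∧
      ∑ k ∈ Finset.range (2 * (r + 1)), (a * x + b * x⁻¹) ^ p ^ k = c) :
    Z.card ≤ p ^ (2 * r + 1) + 4 * p ^ (r + 1) := by
  rcases Z.eq_empty_or_nonempty with rfl | ⟨x₁, hx₁⟩
  · simp
  let d : K := a * x₁ + b * x₁⁻¹
  obtain ⟨L, _, _, Γ, _, v, xL, yL, hv, hxL, hvy, hvx, hrelL⟩ :=
    exists_valuation_artinSchreier K p (by omega) a b d ha
  let I := {P : K × K // P.1 ∈ Z ∧ P.2 ^ p = P.2 + (a * P.1 + b * P.1⁻¹ - d)}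
  let A := L × (I → K)
  have hI0 : ∀ P : I, P.1.1 ≠ 0 := fun P => (hZ _ P.2.1).1
  let x : Aˣ := ⟨(xL, fun P => P.1.1), (xL⁻¹, fun P => P.1.1⁻¹),
    Prod.ext (mul_inv_cancel₀ hxL) (funext fun P => mul_inv_cancel₀ (hI0 P)),
    Prod.ext (inv_mul_cancel₀ hxL) (funext fun P => inv_mul_cancel₀ (hI0 P))⟩
  let y : A := (yL, fun P => P.1.2)
  have hrel : y ^ p = y + (algebraMap K A a * x + algebraMap K A b * ((x⁻¹ : Aˣ) : A)
      - algebraMap K A d) := Prod.ext hrelL (funext fun P => P.2.2)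
  let φ : A →ₐ[K] L := AlgHom.fst K L (I → K)
  let ε : I → A →ₐ[K] K := fun P => (Pi.evalAlgHom K (fun _ => K) P).comp (AlgHom.snd K L (I → K))
  have : CharP A p := charP_of_injective_algebraMap (algebraMap K A).injective p
  have hQ : ∀ (P : I), P.1.2 ^ p ^ (2 * (r + 1)) = P.1.2 := by
    intro P
    rw [pow_prime_pow_eq P.2.2]
    have h1 := (hZ _ P.2.1).2.2
    have h2 : ∑ k ∈ Finset.range (2 * (r + 1)), d ^ p ^ k = c := (hZ _ hx₁).2.2
    simp only [sub_pow_char_pow, Finset.sum_sub_distrib]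
    rw [h1, h2, sub_self, add_zero]
  have hpos : 0 < p ^ r := by positivity
  let ι := (Fin (p ^ r + 3) × Fin p) × (Fin (p ^ r) × Fin p)
  -- the relation in degrees multiplied by `p ^ (r + 1)`
  obtain ⟨g', hg', i₀, hi₀⟩ := exists_relation_of_lt (K := K) x y
    (-((p - 1) * p ^ r + 1)) (((p : ℤ) ^ r - 1) * p ^ (r + 1) + p ^ r + 2 + ((p - 1) * p ^ r + 1)) p
    (fun i : ι => ((x ^ ((i.2.1 : ℕ) * p ^ (r + 1) + i.1.1 : ℤ) : Aˣ) : A) *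
      y ^ ((i.2.2 : ℕ) * p ^ (r + 1) + i.1.2))
    (fun i => by
      refine zpow_mul_pow_mul_pow_mem x y a b d hrel r i.2.2.2 i.1.2.2 ?_ ?_
      · have : (0 : ℤ) ≤ (i.2.1 : ℕ) * p ^ (r + 1) + (i.1.1 : ℕ) := by positivity
        linarith
      · have h1 : (((i.2.1 : ℕ) : ℤ)) ≤ p ^ r - 1 := by
          have := i.2.1.2; zify at this; linarith
        have h2 : (((i.1.1 : ℕ) : ℤ)) ≤ p ^ r + 2 := by
          have := i.1.1.2; zify at this; linarith
        have h3 := mul_le_mul_of_nonneg_right h1 (by positivity : (0 : ℤ) ≤ p ^ (r + 1))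
        linarith)
    (by
      simp only [ι, Fintype.card_prod, Fintype.card_fin]
      rw [← mul_assoc]
      refine Nat.mul_lt_mul_of_pos_right ?_ (by omega)
      zify
      rw [Int.toNat_of_nonneg]
      · have : (1 : ℤ) ≤ p ^ r := by exact_mod_cast hpos
        have : (3 : ℤ) ≤ p := by exact_mod_cast hp3
        rw [pow_succ]
        nlinarith
      · have : (1 : ℤ) ≤ p ^ r := by exact_mod_cast hpos
        have : (3 : ℤ) ≤ p := by exact_mod_cast hp3
        rw [pow_succ]
        have : (0 : ℤ) ≤ (p ^ r - 1) * (p ^ r * p) := by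
          apply mul_nonneg (by linarith); positivity
        nlinarith)
  have hR : 0 < p ^ (r + 1) := by positivity
  choose g hg using fun i => IsAlgClosed.exists_pow_nat_eq (g' i) hR
  let m : ι → A := fun i => ((x ^ ((i.2.1 : ℕ) + i.1.1 * p ^ (r + 1) : ℤ) : Aˣ) : A) *
      y ^ ((i.1.2 : ℕ) * p ^ (r + 1) + i.2.2)
  let G : A := ∑ i, g i • m i
  have hεx : ∀ (P : I) (k : ℤ), ε P ((x ^ k : Aˣ) : A) = P.1.1 ^ k := by
    intro P k
    have := congrArg Units.val (map_zpow (Units.map (ε P : A →* K)) x k)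
    rw [Units.val_zpow_eq_zpow_val] at this
    exact this
  have hφx : ∀ (k : ℤ), φ ((x ^ k : Aˣ) : A) = xL ^ k := by
    intro k
    have := congrArg Units.val (map_zpow (Units.map (φ : A →* L)) x k)
    rw [Units.val_zpow_eq_zpow_val] at this
    exact this
  have hεG : ∀ P : I, ε P G = 0 := by
    intro P
    have : CharP K p := inferInstance
    rw [← pow_eq_zero_iff hR.ne', map_sum, sum_pow_char_pow]
    have h0 : ε P (∑ i : ι, g' i • (((x ^ ((i.2.1 : ℕ) * p ^ (r + 1) + i.1.1 : ℤ) : Aˣ) : A) *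
      y ^ ((i.2.2 : ℕ) * p ^ (r + 1) + i.1.2))) = 0 := by rw [hg', map_zero]
    rw [map_sum] at h0
    rw [← h0]
    refine Finset.sum_congr rfl fun i _ => ?_
    have hy : ε P y = P.1.2 := rfl
    rw [map_smul, map_smul, map_mul, map_mul, hεx, hεx, map_pow, map_pow, hy, smul_eq_mul,
      smul_eq_mul, mul_pow, hg, mul_pow]
    have hRR : p ^ (r + 1) * p ^ (r + 1) = p ^ (2 * (r + 1)) := by rw [← pow_add]; ring_nf
    have e1 : (P.1.1 ^ ((i.2.1 : ℕ) + (i.1.1 : ℕ) * p ^ (r + 1) : ℤ)) ^ p ^ (r + 1) =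
        P.1.1 ^ ((i.2.1 : ℕ) * p ^ (r + 1) + i.1.1 : ℤ) := by
      have hz : (P.1.1 ^ ((i.1.1 : ℕ) * p ^ (r + 1))) ^ p ^ (r + 1) = P.1.1 ^ (i.1.1 : ℕ) := by
        rw [← pow_mul, mul_assoc, hRR, mul_comm, pow_mul, (hZ _ P.2.1).2.1]
      have c1 : ((i.2.1 : ℕ) + (i.1.1 : ℕ) * p ^ (r + 1) : ℤ) =
        (((i.2.1 : ℕ) + (i.1.1 : ℕ) * p ^ (r + 1) : ℕ) : ℤ) := by push_cast; rfl
      have c2 : ((i.2.1 : ℕ) * p ^ (r + 1) + (i.1.1 : ℕ) : ℤ) =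
        (((i.2.1 : ℕ) * p ^ (r + 1) + (i.1.1 : ℕ) : ℕ) : ℤ) := by push_cast; rfl
      rw [c1, c2, zpow_natCast, zpow_natCast, pow_add P.1.1, mul_pow, hz, pow_add P.1.1, ← pow_mul]
    have e2 : (P.1.2 ^ ((i.1.2 : ℕ) * p ^ (r + 1) + i.2.2)) ^ p ^ (r + 1) =
        P.1.2 ^ ((i.2.2 : ℕ) * p ^ (r + 1) + i.1.2) := by
      have hz : (P.1.2 ^ ((i.1.2 : ℕ) * p ^ (r + 1))) ^ p ^ (r + 1) = P.1.2 ^ (i.1.2 : ℕ) := by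
        rw [← pow_mul, mul_assoc, hRR, mul_comm, pow_mul, hQ P]
      rw [pow_add P.1.2, mul_pow, hz, pow_add P.1.2, ← pow_mul, mul_comm]
    rw [e1, e2]
  have hG0 : G ≠ 0 := by
    intro h
    have hφG : ∑ i, g i • φ (m i) = 0 := by
      have := congrArg φ h
      rw [map_zero, map_sum] at this
      simpa only [map_smul] using this
    have hyL : yL ≠ 0 := by
      intro h; rw [h, map_zero] at hvy; exact absurd hvy (not_lt.2 zero_le)
    have hm : ∀ i, φ (m i) = xL ^ ((i.2.1 : ℕ) + i.1.1 * p ^ (r + 1) : ℤ) *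
        yL ^ ((i.1.2 : ℕ) * p ^ (r + 1) + i.2.2) := by
      intro i
      have hy : φ y = yL := rfl
      simp only [m, map_mul, hφx, map_pow, hy]
    have hlin := v.linearIndependent_of_injective (K := K) hv (fun i => φ (m i))
      (fun i => by rw [hm]; exact mul_ne_zero (zpow_ne_zero _ hxL) (pow_ne_zero _ hyL))
      (by
        intro i i' hii
        have hval : ∀ i : ι, v (φ (m i)) = v yL ^ (p ^ (r + 1) * (p * i.1.1 + i.1.2) +
            (p * i.2.1 + i.2.2) : ℕ) := by
          intro i
          have c1 : ((i.2.1 : ℕ) + (i.1.1 : ℕ) * p ^ (r + 1) : ℤ) =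
            (((i.2.1 : ℕ) + (i.1.1 : ℕ) * p ^ (r + 1) : ℕ) : ℤ) := by push_cast; rfl
          rw [hm, c1, zpow_natCast, map_mul, map_pow, map_pow, hvx, ← pow_mul, ← pow_add]
          ring_nf
        simp only [hval] at hii
        have hexp := (pow_right_injective₀ (zero_lt_one.trans hvy) hvy.ne') hii
        have hlt : ∀ i : ι, p * i.2.1 + i.2.2 < p ^ (r + 1) := by
          intro i
          have h1 : p * (i.2.1 + 1) ≤ p * p ^ r := Nat.mul_le_mul_left _ i.2.1.2
          have h2 := i.2.2.2
          rw [pow_succ, mul_comm (p ^ r)]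
          linarith
        obtain ⟨h1, h2⟩ := Nat.mul_add_inj_of_lt (hlt i) (hlt i') hexp
        obtain ⟨h3, h4⟩ := Nat.mul_add_inj_of_lt i.1.2.2 i'.1.2.2 h1
        obtain ⟨h5, h6⟩ := Nat.mul_add_inj_of_lt i.2.2.2 i'.2.2.2 h2
        exact Prod.ext (Prod.ext (Fin.ext h3) (Fin.ext h4)) (Prod.ext (Fin.ext h5) (Fin.ext h6)))
    have := Fintype.linearIndependent_iff.1 hlin g hφG i₀
    apply hi₀
    rw [← hg, this, zero_pow hR.ne']
  have hcard := card_le_of_forall_algHom_eq_zero x y (-((p - 1) * p ^ r + 1))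
    ((p ^ r - 1) + (p ^ r + 2) * p ^ (r + 1) + ((p - 1) * p ^ r + 1)) p G
    (by
      refine sum_mem fun i _ => Submodule.smul_mem _ _ ?_
      refine zpow_mul_pow_mul_pow_mem x y a b d hrel r i.1.2.2 i.2.2.2 ?_ ?_
      · have : (0 : ℤ) ≤ (i.2.1 : ℕ) + (i.1.1 : ℕ) * p ^ (r + 1) := by positivity
        linarith
      · have h1 : (((i.2.1 : ℕ) : ℤ)) ≤ p ^ r - 1 := by
          have := i.2.1.2; zify at this; linarith
        have h2 : (((i.1.1 : ℕ) : ℤ)) ≤ p ^ r + 2 := by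
          have := i.1.1.2; zify at this; linarith
        have h3 := mul_le_mul_of_nonneg_right h2 (by positivity : (0 : ℤ) ≤ p ^ (r + 1))
        linarith) hG0 Z
    (by
      intro x₀ hx₀
      obtain ⟨ys, hys, hy⟩ := card_artinSchreier_fibre p (a * x₀ + b * x₀⁻¹ - d)
      exact ⟨ys, hys.ge, fun y₀ hy₀ => ⟨ε ⟨(x₀, y₀), hx₀, hy y₀ hy₀⟩, rfl, rfl, hεG _⟩⟩)
    (by
      have : (1 : ℤ) ≤ p ^ r := by exact_mod_cast hpos
      have h3 : (3 : ℤ) ≤ p := by exact_mod_cast hp3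
      have h4 : (0 : ℤ) ≤ (p - 1) * p ^ r := mul_nonneg (by linarith) (by linarith)
      have h5 : (0 : ℤ) ≤ (p ^ r + 2) * p ^ (r + 1) := by positivity
      linarith)
  zify
  refine hcard.trans ?_
  have : (1 : ℤ) ≤ p ^ r := by exact_mod_cast hpos
  have e : (p : ℤ) ^ (2 * r + 1) = p ^ r * p ^ (r + 1) := by rw [← pow_add]; ring_nf
  rw [e, pow_succ]
  nlinarith

/-- The Kloosterman sum `∑_{x ≠ 0} ψ(a x + b / x)` over a finite field. -/
noncomputable def kloostermanSum {F : Type*} [Field F] [Fintype F] (ψ : AddChar F ℂ) (a b : F) : ℂ :=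
  ∑ x : F, if x = 0 then 0 else ψ (a * x + b * x⁻¹)

lemma sum_comp_sq_eq {F : Type*} [Field F] [Fintype F] (hF : ringChar F ≠ 2) (H : F → ℂ) :
    ∑ w, H (w ^ 2) = ∑ D, (quadraticChar F D + 1 : ℂ) * H D := by
  rw [← Finset.sum_fiberwise_of_maps_to (s := Finset.univ) (t := Finset.univ)
    (g := fun w : F => w ^ 2) (fun _ _ => Finset.mem_univ _)]
  refine Finset.sum_congr rfl fun D _ => ?_
  rw [Finset.sum_congr rfl (g := fun _ => H D)
    (fun w hw => by rw [(Finset.mem_filter.mp hw).2]), Finset.sum_const, nsmul_eq_mul]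
  congr 1
  have h := quadraticChar_card_sqrts hF D
  have h2 : ({x : F | x ^ 2 = D} : Set F).toFinset = Finset.univ.filter (fun x => x ^ 2 = D) := by
    ext x; simp
  rw [h2] at h
  exact_mod_cast h

lemma sum_comp_sq_add_sum_comp_nonsquare {F : Type*} [Field F] [Fintype F] (hF : ringChar F ≠ 2)
    {d : F} (hd : ¬ IsSquare d) (H : F → ℂ) :
    ∑ w, H (w ^ 2) + ∑ v, H (d * v ^ 2) = 2 * ∑ D, H D := by
  have hd0 : d ≠ 0 := by rintro rfl; exact hd (IsSquare.zero)
  rw [sum_comp_sq_eq hF H, sum_comp_sq_eq hF (fun D => H (d * D)),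
    ← Equiv.sum_comp (Equiv.mulLeft₀ d hd0) (fun D => (quadraticChar F D + 1 : ℂ) * H D),
    ← Equiv.sum_comp (Equiv.mulLeft₀ d hd0) H, Finset.mul_sum, ← Finset.sum_add_distrib]
  refine Finset.sum_congr rfl fun D _ => ?_
  have : quadraticChar F d = -1 := quadraticChar_neg_one_iff_not_isSquare.mpr hd
  simp only [Equiv.mulLeft₀_apply, map_mul, this]
  push_cast
  ring

lemma QuadraticAlgebra.algebraTrace_eq {R : Type*} [CommRing R] [Nontrivial R] {a b : R}
    (z : QuadraticAlgebra R a b) :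
    Algebra.trace R (QuadraticAlgebra R a b) z = 2 * z.re + b * z.im := by
  rw [Algebra.trace_eq_matrix_trace (QuadraticAlgebra.basis a b), Matrix.trace_fin_two,
    Algebra.leftMulMatrix_eq_repr_mul, Algebra.leftMulMatrix_eq_repr_mul]
  have h0 : (QuadraticAlgebra.basis a b) 0 = ⟨1, 0⟩ := by
    apply (QuadraticAlgebra.basis a b).repr.injective
    ext i; fin_cases i <;> simp
  have h1 : (QuadraticAlgebra.basis a b) 1 = ⟨0, 1⟩ := by
    apply (QuadraticAlgebra.basis a b).repr.injective
    ext i; fin_cases i <;> simp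
  rw [h0, h1]
  simp
  ring

lemma kloostermanSum_sq {F : Type*} [Field F] [Fintype F] (hF : ringChar F ≠ 2)
    (ψ : AddChar F ℂ) (a b : F) :
    kloostermanSum ψ a b ^ 2 = ∑ u : F, ∑ w : F,
      if u ^ 2 - w ^ 2 = 0 then 0 else ψ (2 * u * (a + b * (u ^ 2 - w ^ 2)⁻¹)) := by
  have h2 : (2 : F) ≠ 0 := Ring.two_ne_zero hF
  let e : F × F ≃ F × F :=
    { toFun := fun z => (z.1 + z.2, z.1 - z.2)
      invFun := fun z => ((z.1 + z.2) / 2, (z.1 - z.2) / 2)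
      left_inv := fun z => by ext <;> field_simp <;> ring
      right_inv := fun z => by ext <;> field_simp <;> ring }
  rw [sq, kloostermanSum, Finset.sum_mul_sum, ← Fintype.sum_prod_type', ← Fintype.sum_prod_type',
    ← e.sum_comp]
  refine Finset.sum_congr rfl fun z _ => ?_
  obtain ⟨u, w⟩ := z
  change (if u + w = 0 then 0 else _) * (if u - w = 0 then 0 else _) = _
  have h : u ^ 2 - w ^ 2 = (u + w) * (u - w) := by ring
  by_cases h1 : u + w = 0
  · simp [h, h1]
  by_cases h3 : u - w = 0
  · simp [h, h3]
  simp only [h, h1, h3, mul_eq_zero, or_self, if_false]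
  rw [← AddChar.map_add_eq_mul]
  congr 1
  change a * (u + w) + b * (u + w)⁻¹ + (a * (u - w) + b * (u - w)⁻¹) = _
  field_simp
  ring

lemma kloostermanSum_quadraticAlgebra {F : Type*} [Field F] [Fintype F] (hF : ringChar F ≠ 2)
    {d : F} [Fact (∀ r, r ^ 2 ≠ d + 0 * r)] [Fintype (QuadraticAlgebra F d 0)]
    (ψ : AddChar F ℂ) (hψ : ψ ≠ 1) {a b : F} (ha : a ≠ 0) (hb : b ≠ 0) :
    kloostermanSum (F := QuadraticAlgebra F d 0)
      (ψ.compAddMonoidHom (Algebra.trace F (QuadraticAlgebra F d 0)).toAddMonoidHom)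
      (algebraMap _ _ a) (algebraMap _ _ b) = 2 * Fintype.card F - kloostermanSum ψ a b ^ 2 := by
  have h2 : (2 : F) ≠ 0 := Ring.two_ne_zero hF
  have hd : ¬ IsSquare d := by
    rintro ⟨r, hr⟩
    exact (Fact.out : ∀ r, r ^ 2 ≠ d + 0 * r) r (by rw [hr]; ring)
  let G : F → F → ℂ := fun u n => if n = 0 then 0 else ψ (2 * u * (a + b * n⁻¹))
  have hE : kloostermanSum (F := QuadraticAlgebra F d 0)
      (ψ.compAddMonoidHom (Algebra.trace F (QuadraticAlgebra F d 0)).toAddMonoidHom)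
      (algebraMap _ _ a) (algebraMap _ _ b) = ∑ u : F, ∑ v : F, G u (u ^ 2 - d * v ^ 2) := by
    rw [kloostermanSum, ← Fintype.sum_prod_type',
      ← (QuadraticAlgebra.equivProd d 0).symm.sum_comp]
    refine Finset.sum_congr rfl fun z _ => ?_
    obtain ⟨u, v⟩ := z
    have hn : QuadraticAlgebra.norm ((QuadraticAlgebra.equivProd d 0).symm (u, v))
        = u ^ 2 - d * v ^ 2 := by
      rw [QuadraticAlgebra.norm_def]; simp; ring
    have hz : (QuadraticAlgebra.equivProd d 0).symm (u, v) = 0 ↔ u ^ 2 - d * v ^ 2 = 0 := by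
      rw [← hn, QuadraticAlgebra.norm_eq_zero_iff_eq_zero]
    simp only [hz, G]
    congr 1
    change ψ (Algebra.trace F (QuadraticAlgebra F d 0) _) = _
    congr 1
    rw [QuadraticAlgebra.algebraTrace_eq, QuadraticAlgebra.inv_def, hn]
    simp
    ring
  have hsum : ∑ u : F, ∑ v : F, G u (u ^ 2 - d * v ^ 2) + kloostermanSum ψ a b ^ 2
      = 2 * Fintype.card F := by
    rw [kloostermanSum_sq hF, add_comm, ← Finset.sum_add_distrib]
    have h1 : ∀ u : F, ∑ w : F, (if u ^ 2 - w ^ 2 = 0 then 0 else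
        ψ (2 * u * (a + b * (u ^ 2 - w ^ 2)⁻¹))) + ∑ v : F, G u (u ^ 2 - d * v ^ 2)
        = 2 * ∑ n : F, G u n := by
      intro u
      rw [← (Equiv.subLeft (u ^ 2)).sum_comp (G u)]
      exact sum_comp_sq_add_sum_comp_nonsquare hF hd (fun D => G u (u ^ 2 - D))
    rw [Finset.sum_congr rfl (fun u _ => h1 u), ← Finset.mul_sum, Finset.sum_comm]
    congr 1
    have hprim := AddChar.IsPrimitive.of_ne_one hψ
    have h3 : ∀ n : F, ∑ u : F, G u n = if n = -b / a then (Fintype.card F : ℂ) else 0 := by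
      intro n
      by_cases hn : n = 0
      · have : ¬ (0 : F) = -b / a := by
          intro h; field_simp at h; exact hb (by simpa using h.symm)
        simp [G, hn, this]
      · have := AddChar.sum_mulShift (2 * (a + b * n⁻¹)) hprim
        simp only [G, hn, if_false]
        rw [Finset.sum_congr rfl (fun u _ => by
          rw [show 2 * u * (a + b * n⁻¹) = u * (2 * (a + b * n⁻¹)) by ring]), this]
        have h4 : 2 * (a + b * n⁻¹) = 0 ↔ n = -b / a := by
          simp only [mul_eq_zero, h2, false_or]
          field_simp
          constructor
          · intro h; linear_combination h
          · intro h; linear_combination h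
        simp [h4]
    rw [Finset.sum_congr rfl (fun n _ => h3 n)]
    simp
  rw [hE]
  linear_combination hsum

lemma card_trace_eq_le {p : ℕ} [Fact p.Prime] (hp3 : 3 ≤ p) {F : Type} [Field F] [Fintype F]
    [Algebra (ZMod p) F] {r : ℕ} (hF : Fintype.card F = p ^ (2 * (r + 1))) {a : F} (ha : a ≠ 0)
    (b : F) (c : ZMod p) :
    (Finset.univ.filter fun x : F => x ≠ 0 ∧ Algebra.trace (ZMod p) F (a * x + b * x⁻¹) = c).card
      ≤ p ^ (2 * r + 1) + 4 * p ^ (r + 1) := by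
  let K := AlgebraicClosure F
  have hcF : CharP F p := charP_of_injective_algebraMap (algebraMap (ZMod p) F).injective p
  have hcK : CharP K p := charP_of_injective_algebraMap (algebraMap F K).injective p
  have hinj := (algebraMap F K).injective
  have hrank : Module.finrank (ZMod p) F = 2 * (r + 1) := by
    have h := Module.card_eq_pow_finrank (K := ZMod p) (V := F)
    rw [hF, ZMod.card] at h
    exact (Nat.pow_right_injective (Fact.out : p.Prime).two_le h).symm
  rw [← Finset.card_image_of_injective _ hinj]
  refine card_le_of_sum_pow_eq p hp3 (algebraMap F K a) (algebraMap F K b)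
    (algebraMap F K (algebraMap (ZMod p) F c)) (by simpa using ha) r _ ?_
  intro y hy
  obtain ⟨x, hx, rfl⟩ := Finset.mem_image.mp hy
  obtain ⟨hx0, hxc⟩ := (Finset.mem_filter.mp hx).2
  refine ⟨by simpa using hx0, ?_, ?_⟩
  · rw [← map_pow, ← hF, FiniteField.pow_card]
  · rw [← hxc, FiniteField.algebraMap_trace_eq_sum_pow, hrank, map_sum]
    simp

lemma norm_kloostermanSum_le_of_card_eq {p : ℕ} [Fact p.Prime] (hp3 : 3 ≤ p) {F : Type} [Field F]
    [Fintype F] [Algebra (ZMod p) F] {r : ℕ} (hF : Fintype.card F = p ^ (2 * (r + 1)))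
    (ψ : AddChar (ZMod p) ℂ) (hψ : ψ ≠ 1) {a : F} (ha : a ≠ 0) (b : F) :
    ‖kloostermanSum (ψ.compAddMonoidHom (Algebra.trace (ZMod p) F).toAddMonoidHom) a b‖
      ≤ 4 * p * p ^ (r + 1) + 1 := by
  set Z : ZMod p → Finset F := fun c => Finset.univ.filter fun x : F =>
    x ≠ 0 ∧ Algebra.trace (ZMod p) F (a * x + b * x⁻¹) = c with hZ
  set U : ℕ := p ^ (2 * r + 1) + 4 * p ^ (r + 1) with hU
  have hle : ∀ c, (Z c).card ≤ U := fun c => card_trace_eq_le hp3 hF ha b c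
  have hZfib : ∀ c, Z c = (Finset.univ.filter fun x : F => x ≠ 0).filter
      fun x => Algebra.trace (ZMod p) F (a * x + b * x⁻¹) = c := by
    intro c; rw [Finset.filter_filter]
  have hkl : kloostermanSum (ψ.compAddMonoidHom (Algebra.trace (ZMod p) F).toAddMonoidHom) a b
      = ∑ c, ((Z c).card : ℂ) * ψ c := by
    rw [kloostermanSum, Finset.sum_congr rfl (fun x _ => (ite_not (x = 0) _ _).symm),
      ← Finset.sum_filter, ← Finset.sum_fiberwise_of_maps_to (t := Finset.univ)
        (g := fun x : F => Algebra.trace (ZMod p) F (a * x + b * x⁻¹))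
        (fun _ _ => Finset.mem_univ _)]
    refine Finset.sum_congr rfl fun c _ => ?_
    rw [← hZfib, Finset.sum_congr rfl (g := fun _ => ψ c), Finset.sum_const, nsmul_eq_mul]
    intro x hx
    rw [← (Finset.mem_filter.mp hx).2.2]
    rfl
  have hcard : ∑ c, (Z c).card + 1 = Fintype.card F := by
    have h := Finset.card_eq_sum_card_fiberwise (s := Finset.univ.filter fun x : F => x ≠ 0)
      (t := Finset.univ) (f := fun x : F => Algebra.trace (ZMod p) F (a * x + b * x⁻¹))
      (fun _ _ => Finset.mem_univ _)
    simp only [← hZfib] at h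
    rw [← h, Finset.filter_ne', Finset.card_erase_of_mem (Finset.mem_univ _), Finset.card_univ]
    have := Fintype.card_pos (α := F)
    omega
  have h0 : ∑ c, ψ c = 0 := AddChar.sum_eq_zero_of_ne_one hψ
  have h1 : ∑ c, ((Z c).card : ℂ) * ψ c = - ∑ c, ((U : ℂ) - (Z c).card) * ψ c := by
    simp only [sub_mul, Finset.sum_sub_distrib, ← Finset.mul_sum, h0]
    ring
  rw [hkl, h1, norm_neg]
  calc ‖∑ c, ((U : ℂ) - (Z c).card) * ψ c‖ ≤ ∑ c, ((U : ℝ) - (Z c).card) := by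
        refine norm_sum_le_of_le _ fun c _ => ?_
        rw [norm_mul, AddChar.norm_apply, mul_one]
        have : ((U : ℂ) - (Z c).card) = (((U : ℝ) - (Z c).card : ℝ) : ℂ) := by push_cast; rfl
        rw [this, Complex.norm_real, Real.norm_of_nonneg]
        have := hle c
        exact sub_nonneg.mpr (by exact_mod_cast this)
    _ = p * U - ∑ c, ((Z c).card : ℝ) := by
        rw [Finset.sum_sub_distrib]; simp [ZMod.card]
    _ ≤ 4 * p * p ^ (r + 1) + 1 := by
        have h2 : (∑ c, ((Z c).card : ℝ)) + 1 = p ^ (2 * (r + 1)) := by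
          rw [hF] at hcard; exact_mod_cast hcard
        have h3 : (U : ℝ) = p ^ (2 * r + 1) + 4 * p ^ (r + 1) := by rw [hU]; push_cast; rfl
        rw [h3]
        have : (p : ℝ) ^ (2 * (r + 1)) = p * p ^ (2 * r + 1) := by ring
        linarith

lemma exists_extension_kloostermanSum {p : ℕ} [Fact p.Prime] (hp3 : 3 ≤ p)
    (ψ : AddChar (ZMod p) ℂ) (hψ : ψ ≠ 1) {a b : ZMod p} (ha : a ≠ 0) (hb : b ≠ 0) {δ : ℝ}
    (hδ : 0 ≤ δ) (h : (2 + δ) * √p ≤ ‖kloostermanSum ψ a b‖) (k : ℕ) :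
    ∃ (F : Type) (_ : Field F) (_ : Fintype F) (_ : Algebra (ZMod p) F),
      Fintype.card F = p ^ 2 ^ k ∧
      ψ.compAddMonoidHom (Algebra.trace (ZMod p) F).toAddMonoidHom ≠ 1 ∧
      (2 + 4 ^ k * δ) * √(p ^ 2 ^ k : ℝ) ≤
        ‖kloostermanSum (ψ.compAddMonoidHom (Algebra.trace (ZMod p) F).toAddMonoidHom)
          (algebraMap _ F a) (algebraMap _ F b)‖ := by
  induction k with
  | zero =>
    have h1 : ψ.compAddMonoidHom (Algebra.trace (ZMod p) (ZMod p)).toAddMonoidHom = ψ := by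
      ext x; simp
    refine ⟨ZMod p, inferInstance, inferInstance, inferInstance, by simp [ZMod.card], ?_, ?_⟩
    · rwa [h1]
    · rw [h1]; simpa using h
  | succ k ih =>
    obtain ⟨F, _, _, _, hcard, hne, hle⟩ := ih
    have hcF : CharP F p := charP_of_injective_algebraMap (algebraMap (ZMod p) F).injective p
    have hchar : ringChar F ≠ 2 := by rw [ringChar.eq F p]; omega
    obtain ⟨d, hd⟩ := FiniteField.exists_nonsquare hchar
    have hfact : Fact (∀ r : F, r ^ 2 ≠ d + 0 * r) :=
      ⟨fun r hr => hd ⟨r, by rw [← sq, hr]; ring⟩⟩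
    let E := QuadraticAlgebra F d 0
    let iE : Fintype E := Fintype.ofEquiv _ (QuadraticAlgebra.equivProd d 0).symm
    have hcomp : ψ.compAddMonoidHom (Algebra.trace (ZMod p) E).toAddMonoidHom =
        (ψ.compAddMonoidHom (Algebra.trace (ZMod p) F).toAddMonoidHom).compAddMonoidHom
          (Algebra.trace F E).toAddMonoidHom := by
      ext x
      change ψ (Algebra.trace (ZMod p) E x) =
        ψ (Algebra.trace (ZMod p) F (Algebra.trace F E x))
      rw [Algebra.trace_trace]
    refine ⟨E, inferInstance, iE, inferInstance, ?_, ?_, ?_⟩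
    · rw [Fintype.card_congr (QuadraticAlgebra.equivProd d 0), Fintype.card_prod, hcard]
      ring
    · obtain ⟨x, hx⟩ := AddChar.ne_one_iff.mp hne
      refine AddChar.ne_one_iff.mpr ⟨⟨x / 2, 0⟩, ?_⟩
      rw [hcomp]
      change (ψ.compAddMonoidHom (Algebra.trace (ZMod p) F).toAddMonoidHom)
        (Algebra.trace F E ⟨x / 2, 0⟩) ≠ 1
      rw [QuadraticAlgebra.algebraTrace_eq]
      have h2 : (2 : F) ≠ 0 := Ring.two_ne_zero hchar
      simpa [mul_div_cancel₀ _ h2] using hx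
    · rw [hcomp, IsScalarTower.algebraMap_apply (ZMod p) F E a,
        IsScalarTower.algebraMap_apply (ZMod p) F E b,
        kloostermanSum_quadraticAlgebra hchar _ hne (by simpa using ha) (by simpa using hb)]
      set κ := kloostermanSum (ψ.compAddMonoidHom (Algebra.trace (ZMod p) F).toAddMonoidHom)
          (algebraMap _ F a) (algebraMap _ F b)
      have h3 : ‖κ‖ ^ 2 - 2 * (p : ℝ) ^ 2 ^ k ≤ ‖2 * (Fintype.card F : ℂ) - κ ^ 2‖ := by
        have h4 := norm_sub_norm_le (κ ^ 2) (2 * (Fintype.card F : ℂ))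
        rw [norm_sub_rev, norm_pow] at h4
        rw [hcard] at h4 ⊢
        simpa using h4
      refine le_trans ?_ h3
      have h5 : √((p : ℝ) ^ 2 ^ (k + 1)) = (p : ℝ) ^ 2 ^ k := by
        rw [pow_succ 2 k, pow_mul]; exact Real.sqrt_sq (by positivity)
      have h6 : ((2 + 4 ^ k * δ) * √((p : ℝ) ^ 2 ^ k)) ^ 2 ≤ ‖κ‖ ^ 2 :=
        pow_le_pow_left₀ (by positivity) hle 2
      rw [mul_pow, Real.sq_sqrt (by positivity)] at h6
      rw [h5, pow_succ 4 k]
      have h7 : 0 ≤ ((4 : ℝ) ^ k * δ) ^ 2 * (p : ℝ) ^ 2 ^ k := by positivity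
      linarith

/-- The Weil bound for Kloosterman sums over a prime field. -/
theorem norm_kloostermanSum_le {p : ℕ} [Fact p.Prime] (hp3 : 3 ≤ p)
    (ψ : AddChar (ZMod p) ℂ) (hψ : ψ ≠ 1) {a b : ZMod p} (ha : a ≠ 0) (hb : b ≠ 0) :
    ‖kloostermanSum ψ a b‖ ≤ 2 * √p := by
  by_contra! hlt
  have hp0 : 0 < √(p : ℝ) := Real.sqrt_pos.mpr (by exact_mod_cast (by omega : 0 < p))
  set δ := ‖kloostermanSum ψ a b‖ / √p - 2 with hδ
  have hδ0 : 0 < δ := sub_pos.mpr ((lt_div_iff₀ hp0).mpr hlt)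
  have hδ1 : (2 + δ) * √p ≤ ‖kloostermanSum ψ a b‖ := by
    rw [hδ, add_sub_cancel, div_mul_cancel₀ _ hp0.ne']
  obtain ⟨j, hj⟩ := pow_unbounded_of_one_lt ((4 * p + 1) / δ) (by norm_num : (1 : ℝ) < 4)
  rw [div_lt_iff₀ hδ0] at hj
  obtain ⟨F, _, _, _, hcard, -, hle⟩ :=
    exists_extension_kloostermanSum hp3 ψ hψ ha hb hδ0.le hδ1 (j + 1)
  obtain ⟨r, hr⟩ : ∃ r, 2 ^ j = r + 1 := ⟨2 ^ j - 1, by have := Nat.two_pow_pos j; omega⟩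
  have hexp : 2 ^ (j + 1) = 2 * (r + 1) := by rw [pow_succ, hr, mul_comm]
  rw [hexp] at hcard hle
  have hub := norm_kloostermanSum_le_of_card_eq hp3 hcard ψ hψ (a := algebraMap _ F a)
    (by simpa using ha) (algebraMap _ F b)
  have hs : √((p : ℝ) ^ (2 * (r + 1))) = (p : ℝ) ^ (r + 1) := by
    rw [mul_comm, pow_mul]; exact Real.sqrt_sq (by positivity)
  rw [hs] at hle
  have hP : (1 : ℝ) ≤ (p : ℝ) ^ (r + 1) := one_le_pow₀ (by exact_mod_cast (by omega : 1 ≤ p))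
  have h1 : (4 * p + 1 : ℝ) < 4 ^ (j + 1) * δ := by
    have : (0 : ℝ) < 4 ^ j * δ := by positivity
    rw [pow_succ]; linarith
  have h2 := hle.trans hub
  nlinarith [mul_lt_mul_of_pos_right h1 (lt_of_lt_of_le one_pos hP)]

lemma sum_quadraticChar_sq_sub_mul {F : Type*} [Field F] [Fintype F] [DecidableEq F]
    (hF : ringChar F ≠ 2) (ψ : AddChar F ℂ) {A : F} (hA : A ≠ 0) (h : F) :
    ∑ t, (quadraticChar F (t ^ 2 - A) : ℂ) * ψ (h * t) =
      kloostermanSum ψ (h / 2) (h * A / 2) - ∑ t, ψ (h * t) := by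
  have h2 : (2 : F) ≠ 0 := Ring.two_ne_zero hF
  rw [eq_sub_iff_add_eq, ← Finset.sum_add_distrib]
  have h1 : ∀ t : F, (quadraticChar F (t ^ 2 - A) : ℂ) * ψ (h * t) + ψ (h * t) =
      ∑ y : F, if y ^ 2 = t ^ 2 - A then ψ (h * t) else 0 := by
    intro t
    have h := quadraticChar_card_sqrts hF (t ^ 2 - A)
    have h3 : ({x : F | x ^ 2 = t ^ 2 - A} : Set F).toFinset =
        Finset.univ.filter (fun x => x ^ 2 = t ^ 2 - A) := by
      ext x; simp
    rw [h3] at h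
    rw [← Finset.sum_filter, Finset.sum_const, nsmul_eq_mul]
    have h4 : ((Finset.univ.filter (fun x : F => x ^ 2 = t ^ 2 - A)).card : ℂ) =
        quadraticChar F (t ^ 2 - A) + 1 := by exact_mod_cast h
    rw [h4]; ring
  let e : F × F ≃ F × F :=
    { toFun := fun z => ((z.1 + z.2) / 2, (z.2 - z.1) / 2)
      invFun := fun z => (z.1 - z.2, z.1 + z.2)
      left_inv := fun z => by ext <;> field_simp <;> ring
      right_inv := fun z => by ext <;> field_simp <;> ring }
  rw [Finset.sum_congr rfl (fun t _ => h1 t), ← Fintype.sum_prod_type', ← e.sum_comp,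
    Fintype.sum_prod_type, kloostermanSum]
  refine Finset.sum_congr rfl fun u _ => ?_
  have h5 : ∀ s : F, (((s - u) / 2) ^ 2 = ((u + s) / 2) ^ 2 - A ↔ u * s = A) := by
    intro s
    rw [div_pow, div_pow, div_eq_iff (pow_ne_zero 2 h2), sub_mul,
      div_mul_cancel₀ _ (pow_ne_zero 2 h2)]
    constructor
    · intro h
      have : (2 : F) ^ 2 * (u * s - A) = 0 := by linear_combination -h
      exact sub_eq_zero.mp ((mul_eq_zero.mp this).resolve_left (pow_ne_zero 2 h2))
    · intro h; linear_combination -4 * h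
  by_cases hu : u = 0
  · subst hu
    simp only [if_true]
    refine Finset.sum_eq_zero fun s _ => ?_
    have := (h5 s).not.mpr (by simpa using hA.symm)
    exact if_neg this
  · rw [if_neg hu, Finset.sum_eq_single (A * u⁻¹)]
    · refine (if_pos ((h5 _).mpr ?_)).trans ?_
      · rw [mul_left_comm, mul_inv_cancel₀ hu, mul_one]
      change ψ (h * ((u + A * u⁻¹) / 2)) = _
      congr 1
      ring
    · intro s _ hs
      refine if_neg ((h5 s).not.mpr fun h6 => hs ?_)
      rw [← h6]; field_simp
    · simp

lemma sum_eq_sum_fourier {N : ℕ} [NeZero N] (f : ZMod N → ℂ) (S : Finset ℤ) :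
    ∑ t ∈ S, f t = (N : ℂ)⁻¹ * ∑ h : ZMod N,
      (∑ s, f s * ZMod.stdAddChar (h * s)) * ∑ t ∈ S, ZMod.stdAddChar (-(h * (t : ZMod N))) := by
  have hN : (N : ℂ) ≠ 0 := by exact_mod_cast NeZero.ne N
  rw [eq_inv_mul_iff_mul_eq₀ hN]
  calc (N : ℂ) * ∑ t ∈ S, f t
      = ∑ t ∈ S, ∑ s, f s * ∑ h : ZMod N, ZMod.stdAddChar (h * (s - (t : ZMod N))) := by
        rw [Finset.mul_sum]
        refine Finset.sum_congr rfl fun t _ => ?_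
        simp_rw [AddChar.sum_mulShift _ (ZMod.isPrimitive_stdAddChar N), sub_eq_zero, ZMod.card]
        simp [mul_comm]
    _ = ∑ t ∈ S, ∑ s, ∑ h : ZMod N,
          f s * ZMod.stdAddChar (h * s) * ZMod.stdAddChar (-(h * (t : ZMod N))) := by
        refine Finset.sum_congr rfl fun t _ => Finset.sum_congr rfl fun s _ => ?_
        rw [Finset.mul_sum]
        refine Finset.sum_congr rfl fun h _ => ?_
        rw [mul_assoc, ← AddChar.map_add_eq_mul]
        ring_nf
    _ = _ := by
        simp_rw [Finset.sum_mul_sum]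
        rw [Finset.sum_congr rfl (fun t _ => Finset.sum_comm), Finset.sum_comm]
        exact Finset.sum_congr rfl fun h _ => Finset.sum_comm

lemma sub_one_mul_sum_Icc_addChar {R : Type*} [CommRing R] (ψ : AddChar R ℂ) (h : R) (n : ℕ) :
    (ψ (-h) - 1) * ∑ t ∈ Finset.Icc (-(n : ℤ)) n, ψ (-(h * (t : R))) =
      ψ (-(h * (n + 1))) - ψ (h * n) := by
  induction n with
  | zero => simp
  | succ n ih =>
    have hI : Finset.Icc (-((n + 1 : ℕ) : ℤ)) ((n + 1 : ℕ) : ℤ) =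
        insert ((n : ℤ) + 1) (insert (-((n : ℤ) + 1)) (Finset.Icc (-(n : ℤ)) n)) := by
      ext x; simp only [Finset.mem_insert, Finset.mem_Icc]; push_cast; omega
    rw [hI, Finset.sum_insert, Finset.sum_insert, mul_add, mul_add, ih]
    · push_cast
      rw [sub_mul, sub_mul, ← AddChar.map_add_eq_mul, ← AddChar.map_add_eq_mul]
      ring_nf
    · simp
    · simp only [Finset.mem_insert, Finset.mem_Icc]; omega

lemma inv_sin_pi_mul_le {N j : ℕ} (hj0 : 0 < j) (hjN : j < N) :
    (|Real.sin (Real.pi * j / N)|)⁻¹ ≤ N / 2 * ((j : ℝ)⁻¹ + (N - j : ℝ)⁻¹) := by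
  have hj : (0 : ℝ) < j := by exact_mod_cast hj0
  have hN : (0 : ℝ) < N := by exact_mod_cast hj0.trans hjN
  have hd : (0 : ℝ) < N - j := sub_pos.mpr (by exact_mod_cast hjN)
  have key : ∀ x : ℝ, 0 < x → x ≤ N / 2 → (|Real.sin (Real.pi * x / N)|)⁻¹ ≤ N / 2 * x⁻¹ := by
    intro x hx hx2
    have h1 := Real.mul_le_sin (x := Real.pi * x / N) (by positivity) (by
      rw [div_le_div_iff₀ hN two_pos]; nlinarith [Real.pi_pos])
    have h2 : 2 / Real.pi * (Real.pi * x / N) = 2 * x / N := by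
      field_simp
    rw [h2] at h1
    have h3 : N / 2 * x⁻¹ = (2 * x / N)⁻¹ := by field_simp
    rw [h3]
    exact inv_anti₀ (by positivity) (h1.trans (le_abs_self _))
  rcases le_total (j : ℝ) (N / 2) with h | h
  · refine (key j hj h).trans ?_
    gcongr
    have := inv_pos.mpr hd
    linarith
  · have h1 := key (N - j) hd (by linarith)
    have h2 : Real.pi * (N - j) / N = Real.pi - Real.pi * j / N := by field_simp
    rw [h2, Real.sin_pi_sub] at h1
    refine h1.trans ?_
    gcongr
    have := inv_pos.mpr hj
    linarith

lemma norm_sum_Icc_stdAddChar_le {N : ℕ} [NeZero N] {h : ZMod N} (hh : h ≠ 0) (n : ℕ) :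
    ‖∑ t ∈ Finset.Icc (-(n : ℤ)) n, ZMod.stdAddChar (-(h * (t : ZMod N)))‖ ≤
      N / 2 * ((h.val : ℝ)⁻¹ + (N - h.val : ℝ)⁻¹) := by
  have hval : 0 < h.val := ZMod.val_pos.mpr hh
  refine le_trans ?_ (inv_sin_pi_mul_le hval h.val_lt)
  have h1 : ‖ZMod.stdAddChar (-h) - 1‖ = 2 * |Real.sin (Real.pi * h.val / N)| := by
    have h2 : -h = ((-(h.val : ℤ) : ℤ) : ZMod N) := by simp
    have h3 : (2 * Real.pi * Complex.I * ((-(h.val : ℤ) : ℤ) : ℂ) / N : ℂ) =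
        Complex.I * ((-(2 * (Real.pi * h.val / N)) : ℝ) : ℂ) := by push_cast; ring
    rw [h2, ZMod.stdAddChar_coe, h3, Complex.norm_exp_I_mul_ofReal_sub_one, neg_div,
      mul_div_cancel_left₀ _ (two_ne_zero), Real.sin_neg]
    simp
  have h4 := congrArg norm (sub_one_mul_sum_Icc_addChar ZMod.stdAddChar h n)
  rw [norm_mul, h1] at h4
  have h5 : ‖ZMod.stdAddChar (-(h * ((n : ZMod N) + 1))) - ZMod.stdAddChar (h * (n : ZMod N))‖ ≤ 2 := by
    refine (norm_sub_le _ _).trans ?_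
    rw [AddChar.norm_apply, AddChar.norm_apply]; norm_num
  have hs : 0 < |Real.sin (Real.pi * h.val / N)| := by
    refine abs_pos.mpr (Real.sin_pos_of_pos_of_lt_pi ?_ ?_).ne'
    · have : (0 : ℝ) < N := by exact_mod_cast NeZero.pos N
      positivity
    · have : (0 : ℝ) < N := by exact_mod_cast NeZero.pos N
      rw [div_lt_iff₀ this]
      have : (h.val : ℝ) < N := by exact_mod_cast h.val_lt
      exact mul_lt_mul_of_pos_left this Real.pi_pos
  rw [← h4] at h5
  rw [← one_div, le_div_iff₀ hs]
  linarith

lemma sum_range_inv_add_inv_le (N : ℕ) :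
    ∑ j ∈ Finset.range N, ((j : ℝ)⁻¹ + (N - j : ℝ)⁻¹) ≤ 2 * (1 + Real.log N) := by
  have hH : ∑ i ∈ Finset.range N, ((i : ℝ) + 1)⁻¹ ≤ 1 + Real.log N := by
    have := harmonic_le_one_add_log N
    simpa [harmonic] using this
  have h1 : ∑ j ∈ Finset.range N, (j : ℝ)⁻¹ ≤ ∑ i ∈ Finset.range N, ((i : ℝ) + 1)⁻¹ := by
    cases N with
    | zero => simp
    | succ m =>
      rw [Finset.sum_range_succ', Finset.sum_range_succ]
      have : (0 : ℝ) ≤ ((m : ℝ) + 1)⁻¹ := by positivity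
      simpa using this
  have h2 : ∑ j ∈ Finset.range N, (N - j : ℝ)⁻¹ = ∑ i ∈ Finset.range N, ((i : ℝ) + 1)⁻¹ := by
    rw [← Finset.sum_range_reflect]
    refine Finset.sum_congr rfl fun j hj => ?_
    have := Finset.mem_range.mp hj
    have h3 : ((N - 1 - j : ℕ) : ℝ) = N - 1 - j := by
      rw [Nat.cast_sub (by omega), Nat.cast_sub (by omega)]; simp
    rw [h3]; ring_nf
  rw [Finset.sum_add_distrib, h2]
  linarith

/-- Incomplete sums of the quadratic character of `t² - A`. -/
theorem abs_sum_Icc_quadraticChar_sq_sub_le {p : ℕ} [Fact p.Prime] (hp3 : 3 ≤ p) {A : ZMod p}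
    (hA : A ≠ 0) (n : ℕ) :
    |∑ t ∈ Finset.Icc (-(n : ℤ)) n, (quadraticChar (ZMod p) ((t : ZMod p) ^ 2 - A) : ℝ)| ≤
      (2 * n + 1) / p + 2 * √p * (1 + Real.log p) := by
  have hp0 : (0 : ℝ) < p := by exact_mod_cast (by omega : 0 < p)
  have hchar : ringChar (ZMod p) ≠ 2 := by rw [ZMod.ringChar_zmod_n]; omega
  have h2 : (2 : ZMod p) ≠ 0 := Ring.two_ne_zero hchar
  set ψ : AddChar (ZMod p) ℂ := ZMod.stdAddChar with hψ
  have hprim : ψ.IsPrimitive := ZMod.isPrimitive_stdAddChar p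
  have hψ1 : ψ ≠ 1 := by
    intro h
    have := hprim (one_ne_zero)
    rw [AddChar.mulShift_one] at this
    exact this h
  set f : ZMod p → ℂ := fun t => (quadraticChar (ZMod p) (t ^ 2 - A) : ℂ) with hf
  have hsum : ∀ h : ZMod p, ∑ t, ψ (h * t) = if h = 0 then (p : ℂ) else 0 := by
    intro h
    have := AddChar.sum_mulShift h hprim
    rw [ZMod.card] at this
    push_cast at this
    rw [← this]
    exact Finset.sum_congr rfl fun t _ => by rw [mul_comm]
  have hcoef0 : ∑ s, f s * ψ (0 * s) = -1 := by
    have h := sum_quadraticChar_sq_sub_mul hchar ψ hA 0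
    rw [hsum, if_pos rfl] at h
    refine h.trans ?_
    rw [kloostermanSum]
    simp only [zero_div, zero_mul, add_zero, AddChar.map_zero_eq_one]
    rw [← Finset.sum_filter_add_sum_filter_not Finset.univ (fun x : ZMod p => x = 0)]
    rw [Finset.sum_ite_of_true (by simp), Finset.sum_ite_of_false (by simp), Finset.filter_ne',
      Finset.sum_const, Finset.sum_const, Finset.card_erase_of_mem (Finset.mem_univ _),
      Finset.card_univ, ZMod.card, nsmul_eq_mul, nsmul_eq_mul, Nat.cast_sub (by omega)]
    simp
  have hcoef : ∀ h : ZMod p, h ≠ 0 → ‖∑ s, f s * ψ (h * s)‖ ≤ 2 * √p := by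
    intro h hh
    have h3 := sum_quadraticChar_sq_sub_mul hchar ψ hA h
    rw [hsum, if_neg hh, sub_zero] at h3
    refine (congrArg norm h3).trans_le ?_
    exact norm_kloostermanSum_le hp3 ψ hψ1 (div_ne_zero hh h2)
      (div_ne_zero (mul_ne_zero hh hA) h2)
  set B : ℕ → ℝ := fun j => (if j = 0 then (2 * n + 1 : ℝ) else 0) +
    p * √p * ((j : ℝ)⁻¹ + (p - j : ℝ)⁻¹) with hB
  have hterm : ∀ h : ZMod p, ‖(∑ s, f s * ψ (h * s)) *
      ∑ t ∈ Finset.Icc (-(n : ℤ)) n, ψ (-(h * (t : ZMod p)))‖ ≤ B h.val := by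
    intro h
    rw [norm_mul]
    by_cases hh : h = 0
    · subst hh
      rw [hcoef0]
      have hc : ‖∑ t ∈ Finset.Icc (-(n : ℤ)) n, ψ (-(0 * (t : ZMod p)))‖ = 2 * n + 1 := by
        simp only [zero_mul, neg_zero, AddChar.map_zero_eq_one, Finset.sum_const, nsmul_eq_mul,
          mul_one, Int.card_Icc, Complex.norm_natCast]
        have : ((n : ℤ) + 1 - -(n : ℤ)).toNat = 2 * n + 1 := by omega
        rw [this]; push_cast; rfl
      rw [hc]
      simp only [hB, ZMod.val_zero, if_true]
      have : (0 : ℝ) ≤ p * √p * (((0 : ℕ) : ℝ)⁻¹ + (p - (0 : ℕ) : ℝ)⁻¹) := by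
        simp only [Nat.cast_zero, inv_zero, sub_zero]; positivity
      rw [norm_neg, norm_one]
      linarith
    · have hv : h.val ≠ 0 := by simpa using hh
      simp only [hB, if_neg hv, zero_add]
      calc _ ≤ 2 * √p * (p / 2 * ((h.val : ℝ)⁻¹ + (p - h.val : ℝ)⁻¹)) :=
            mul_le_mul (hcoef h hh) (norm_sum_Icc_stdAddChar_le hh n) (norm_nonneg _)
              (by positivity)
        _ = _ := by ring
  have hval : ∑ h : ZMod p, B h.val = ∑ j ∈ Finset.range p, B j := by
    refine Finset.sum_nbij' (fun h => h.val) (fun j => (j : ZMod p)) ?_ ?_ ?_ ?_ ?_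
    · intro h _; exact Finset.mem_range.mpr h.val_lt
    · intro _ _; exact Finset.mem_univ _
    · intro h _; exact ZMod.natCast_zmod_val h
    · intro j hj; exact ZMod.val_cast_of_lt (Finset.mem_range.mp hj)
    · intro _ _; rfl
  have hBsum : ∑ j ∈ Finset.range p, B j ≤ (2 * n + 1) + p * √p * (2 * (1 + Real.log p)) := by
    simp only [hB, Finset.sum_add_distrib (g := fun j : ℕ => p * √p * ((j : ℝ)⁻¹ + (p - j : ℝ)⁻¹)),
      ← Finset.mul_sum]
    rw [Finset.sum_ite_eq' , if_pos (Finset.mem_range.mpr (by omega))]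
    have := sum_range_inv_add_inv_le p
    gcongr
  have hC : ((∑ t ∈ Finset.Icc (-(n : ℤ)) n,
      (quadraticChar (ZMod p) ((t : ZMod p) ^ 2 - A) : ℝ) : ℝ) : ℂ) =
      ∑ t ∈ Finset.Icc (-(n : ℤ)) n, f t := by
    push_cast; rfl
  rw [← Real.norm_eq_abs, ← Complex.norm_real, hC, sum_eq_sum_fourier f, norm_mul, norm_inv,
    Complex.norm_natCast]
  calc (p : ℝ)⁻¹ * _ ≤ (p : ℝ)⁻¹ * ((2 * n + 1) + p * √p * (2 * (1 + Real.log p))) := by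
        gcongr
        refine (norm_sum_le_of_le _ fun h _ => hterm h).trans ?_
        rw [hval]; exact hBsum
    _ = _ := by field_simp

lemma card_Icc_filter_cast_eq_le {N : ℕ} [NeZero N] (n : ℕ) (s : ZMod N) :
    (((Finset.Icc (-(n : ℤ)) n).filter fun t : ℤ => (t : ZMod N) = s).card : ℝ) ≤
      (2 * n + 1) / N + 1 := by
  have hN : (0 : ℤ) < N := by exact_mod_cast NeZero.pos N
  have hNq : (0 : ℚ) < N := by exact_mod_cast NeZero.pos N
  have h1 : (Finset.Icc (-(n : ℤ)) n).filter (fun t : ℤ => (t : ZMod N) = s) =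
      (Finset.Ioc (-(n : ℤ) - 1) n).filter (fun t : ℤ => t ≡ (s.val : ℤ) [ZMOD (N : ℤ)]) := by
    ext t
    simp only [Finset.mem_filter, Finset.mem_Icc, Finset.mem_Ioc, ← ZMod.intCast_eq_intCast_iff]
    rw [Int.cast_natCast, ZMod.natCast_zmod_val, Int.sub_one_lt_iff]
  have h2 := Int.Ioc_filter_modEq_card (-(n : ℤ) - 1) n hN s.val
  rw [← h1] at h2
  have h3 : (((Finset.Icc (-(n : ℤ)) n).filter fun t : ℤ => (t : ZMod N) = s).card : ℚ) ≤
      (2 * n + 1) / N + 1 := by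
    have h4 : (((Finset.Icc (-(n : ℤ)) n).filter fun t : ℤ => (t : ZMod N) = s).card : ℚ) =
      ((((Finset.Icc (-(n : ℤ)) n).filter fun t : ℤ => (t : ZMod N) = s).card : ℤ) : ℚ) := by simp
    rw [h4, h2, Int.cast_max]
    refine max_le ?_ (by simp only [Int.cast_zero]; positivity)
    push_cast
    have ha := Int.floor_le (((n : ℚ) - s.val) / N)
    have hb := Int.lt_floor_add_one ((-(n : ℚ) - 1 - s.val) / N)
    have hc : ((n : ℚ) - s.val) / N - (-(n : ℚ) - 1 - s.val) / N = (2 * n + 1) / N := by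
      rw [← sub_div]; ring_nf
    linarith
  have h4 := (Rat.cast_le (K := ℝ)).mpr h3
  push_cast at h4
  exact h4

lemma card_Icc_filter_sq_eq_le {p : ℕ} [Fact p.Prime] (hp3 : 3 ≤ p) (A : ZMod p) (n : ℕ) :
    (((Finset.Icc (-(n : ℤ)) n).filter fun t : ℤ => (t : ZMod p) ^ 2 = A).card : ℝ) ≤
      2 * ((2 * n + 1) / p + 1) := by
  have hchar : ringChar (ZMod p) ≠ 2 := by rw [ZMod.ringChar_zmod_n]; omega
  have h := quadraticChar_card_sqrts hchar A
  set T := ({x : ZMod p | x ^ 2 = A} : Set (ZMod p)).toFinset with hT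
  have hT2 : T.card ≤ 2 := by
    have h1 : quadraticChar (ZMod p) A ≤ 1 := by
      by_cases hA : A = 0
      · simp [hA]
      · rcases quadraticChar_dichotomy hA with h | h <;> rw [h]; norm_num
    omega
  rw [Finset.card_eq_sum_card_fiberwise (t := T) (f := fun t : ℤ => (t : ZMod p))
    (fun t ht => by simpa [hT] using (Finset.mem_filter.mp ht).2)]
  push_cast
  have hpos : (0 : ℝ) ≤ (2 * n + 1) / p + 1 := by positivity
  calc _ ≤ ∑ _s ∈ T, ((2 * n + 1 : ℝ) / p + 1) := by
        refine Finset.sum_le_sum fun s _ => le_trans ?_ (card_Icc_filter_cast_eq_le n s)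
        exact_mod_cast Finset.card_le_card fun t ht => by
          simp only [Finset.mem_filter] at ht ⊢
          exact ⟨ht.1.1, ht.2⟩
    _ ≤ _ := by
        rw [Finset.sum_const, nsmul_eq_mul]
        gcongr
        exact_mod_cast hT2

theorem half_hasse_interval_square :
    ∃ C : ℝ, 0 < C ∧ ∀ q : ℕ, IsPrimePow q → ∀ ℓ : ℕ, ℓ.Prime → ¬ ℓ ∣ 2 * q →
      |(((Finset.Icc (-⌊2 * Real.sqrt q⌋) ⌊2 * Real.sqrt q⌋).filter
            (fun t : ℤ => IsSquare ((t ^ 2 - 4 * q : ℤ) : ZMod ℓ))).card : ℝ) -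
          2 * Real.sqrt q| ≤
        C * (Real.sqrt ℓ * Real.log ℓ + Real.sqrt q / ℓ) := by
  refine ⟨6, by norm_num, fun q _ ℓ hℓ hdvd => ?_⟩
  obtain ⟨n, hn⟩ : ∃ n : ℕ, ⌊2 * √(q : ℝ)⌋ = n :=
    Int.eq_ofNat_of_zero_le (Int.floor_nonneg.mpr (by positivity))
  rw [hn]
  set I := Finset.Icc (-(n : ℤ)) n with hI
  set R := (I.filter (fun t : ℤ => IsSquare ((t ^ 2 - 4 * q : ℤ) : ZMod ℓ))).card with hR
  have : Fact ℓ.Prime := ⟨hℓ⟩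
  have h2ℓ : ¬ ℓ ∣ 2 := fun h => hdvd (h.mul_right q)
  have hℓ3 : 3 ≤ ℓ := by
    have := hℓ.two_le
    rcases this.lt_or_eq with h | h
    · exact h
    · exact absurd (h ▸ dvd_rfl) h2ℓ
  have hA : (4 * q : ZMod ℓ) ≠ 0 := by
    have h : ((2 * (2 * q) : ℕ) : ZMod ℓ) ≠ 0 := by
      rw [Ne, ZMod.natCast_eq_zero_iff, hℓ.dvd_mul, not_or]
      exact ⟨h2ℓ, hdvd⟩
    intro h0
    apply h
    push_cast
    linear_combination h0
  have hn1 : (n : ℝ) ≤ 2 * √q := by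
    have := Int.floor_le (2 * √(q : ℝ)); rw [hn] at this; exact_mod_cast this
  have hn2 : 2 * √q < (n : ℝ) + 1 := by
    have := Int.lt_floor_add_one (2 * √(q : ℝ)); rw [hn] at this; exact_mod_cast this
  set S : ℝ := ∑ t ∈ I, (quadraticChar (ZMod ℓ) ((t : ZMod ℓ) ^ 2 - 4 * q) : ℝ) with hS
  set Z := (I.filter (fun t : ℤ => (t : ZMod ℓ) ^ 2 = 4 * q)).card with hZ
  have hmain : 2 * (R : ℝ) = (2 * n + 1) + S + Z := by
    have hc : (2 * n + 1 : ℝ) = ∑ _t ∈ I, (1 : ℝ) := by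
      rw [Finset.sum_const, hI, Int.card_Icc, nsmul_eq_mul, mul_one]
      have : ((n : ℤ) + 1 - -(n : ℤ)).toNat = 2 * n + 1 := by omega
      rw [this]; push_cast; rfl
    rw [hc, hS, hR, hZ, Finset.card_filter, Finset.card_filter]
    push_cast
    rw [Finset.mul_sum, ← Finset.sum_add_distrib, ← Finset.sum_add_distrib]
    refine Finset.sum_congr rfl fun t _ => ?_
    have hz : (t : ZMod ℓ) ^ 2 = 4 * q ↔ (t : ZMod ℓ) ^ 2 - 4 * q = 0 := sub_eq_zero.symm
    by_cases hx : (t : ZMod ℓ) ^ 2 - 4 * q = 0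
    · rw [if_pos (hz.mpr hx), hx, if_pos IsSquare.zero]
      simp
      norm_num
    · rw [if_neg (hz.not.mpr hx)]
      by_cases hsq : IsSquare ((t : ZMod ℓ) ^ 2 - 4 * q)
      · rw [(quadraticChar_one_iff_isSquare hx).mpr hsq, if_pos hsq]
        norm_num
      · rw [quadraticChar_neg_one_iff_not_isSquare.mpr hsq, if_neg hsq]
        norm_num
  have hSle := abs_sum_Icc_quadraticChar_sq_sub_le hℓ3 hA n
  have hZle := card_Icc_filter_sq_eq_le hℓ3 (4 * q : ZMod ℓ) n
  rw [← hI, ← hS] at hSle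
  rw [← hI, ← hZ] at hZle
  have hZ0 : (0 : ℝ) ≤ Z := Nat.cast_nonneg _
  have hℓr : (3 : ℝ) ≤ ℓ := by exact_mod_cast hℓ3
  have hlog : 1 ≤ Real.log ℓ := by
    rw [Real.le_log_iff_exp_le (by linarith)]
    linarith [Real.exp_one_lt_d9]
  have hsqrt : 1 ≤ √(ℓ : ℝ) := Real.one_le_sqrt.mpr (by linarith)
  have hprod : √(ℓ : ℝ) ≤ √ℓ * Real.log ℓ := le_mul_of_one_le_right (by positivity) hlog
  have hN : (2 * n + 1 : ℝ) / ℓ ≤ 4 * (√q / ℓ) + 1 / 3 := by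
    have h1 : (2 * n + 1 : ℝ) / ℓ ≤ (4 * √q + 1) / ℓ :=
      div_le_div_of_nonneg_right (by linarith) (by positivity)
    have h2 : (1 : ℝ) / ℓ ≤ 1 / 3 := one_div_le_one_div_of_le (by norm_num) hℓr
    calc _ ≤ _ := h1
      _ = 4 * (√q / ℓ) + 1 / ℓ := by ring
      _ ≤ _ := by gcongr
  have hq0 : 0 ≤ √(q : ℝ) / ℓ := by positivity
  rw [abs_le] at hSle ⊢
  constructor <;> linarith [hSle.1, hSle.2]
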